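/- Let a countable sofic group G (with fixed sofic approximation sequence Σ) act continuously on compact metrizable spaces X_n for 1 ≤ n < R, where R ∈ ℕ ∪ {∞}, and consider the product action of G on X = ∏_{1≤n<R} X_n. Then mdim_Σ(X) ≤ ∑_{1≤n<R} mdim_Σ(X_n), where all the values lie in {−∞} ∪ [0,+∞], the sum is interpreted as the supremum of the finite partial sums when every term is ≥ 0, and as −∞ if some term equals −∞. -/

import Mathlib

open Filter Topology TopologicalSpace
open scoped ENat
open scoped Classical Pointwise

namespace SoficMD

/-- A sofic approximation sequence for a group `G`. -/
structure SoficApprox (G : Type*) [Group G] where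
  d : ℕ → ℕ
  σ : ∀ i, G → Equiv.Perm (Fin (d i))
  approx_mul : ∀ s t : G, Tendsto
    (fun i => ((Finset.univ.filter fun a : Fin (d i) => σ i s (σ i t a) = σ i (s * t) a).card : ℝ) / (d i : ℝ))
    atTop (𝓝 1)
  approx_sep : ∀ s t : G, s ≠ t → Tendsto
    (fun i => ((Finset.univ.filter fun a : Fin (d i) => σ i s a = σ i t a).card : ℝ) / (d i : ℝ))
    atTop (𝓝 0)
  d_tendsto : Tendsto d atTop atTop

/-- A continuous pseudometric on a topological space. -/
structure ContPseudoMetric (X : Type*) [TopologicalSpace X] where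
  d : X → X → ℝ
  continuous' : Continuous fun p : X × X => d p.1 p.2
  nonneg : ∀ x y, 0 ≤ d x y
  symm : ∀ x y, d x y = d y x
  refl : ∀ x, d x x = 0
  triangle : ∀ x y z, d x z ≤ d x y + d y z

/-- A continuous pseudometric on a compact Hausdorff space is a compatible metric iff it
separates points. -/
def ContPseudoMetric.IsCompatMetric {X : Type*} [TopologicalSpace X]
    (ρ : ContPseudoMetric X) : Prop :=
  ∀ x y : X, ρ.d x y = 0 → x = y

/-- A continuous pseudometric is dynamically generating if translates separate points. -/
def DynGenerating (G : Type*) {X : Type*} [Group G] [TopologicalSpace X] [MulAction G X]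
    (ρ : ContPseudoMetric X) : Prop :=
  ∀ x y : X, x ≠ y → ∃ s : G, 0 < ρ.d (s • x) (s • y)

/-- Equivariance of a map between two `G`-spaces. -/
def Equivariant (G : Type*) {A B : Type*} [SMul G A] [SMul G B] (f : A → B) : Prop :=
  ∀ (s : G) (a : A), f (s • a) = s • f a

/-- The normalized ℓ² pseudometric on maps `[d] → X`. -/
noncomputable def rho2 {X : Type*} [TopologicalSpace X] (ρ : ContPseudoMetric X) {d : ℕ}
    (φ ψ : Fin d → X) : ℝ :=
  Real.sqrt ((1 / (d : ℝ)) * ∑ a, (ρ.d (φ a) (ψ a)) ^ 2)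

/-- The ℓ^∞ pseudometric on maps `[d] → X`. -/
noncomputable def rhoInfty {X : Type*} [TopologicalSpace X] (ρ : ContPseudoMetric X) {d : ℕ}
    (φ ψ : Fin d → X) : ℝ :=
  ⨆ a : Fin d, ρ.d (φ a) (ψ a)

/-- The space of `(ρ, F, δ)`-approximately equivariant maps `[d] → X` relative to `σ`. -/
def MapSpace {G X : Type*} [Group G] [TopologicalSpace X] [MulAction G X]
    (ρ : ContPseudoMetric X) (F : Finset G) (δ : ℝ) {d : ℕ}
    (σ : G → Equiv.Perm (Fin d)) : Set (Fin d → X) :=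
  {φ | ∀ s ∈ F, rho2 ρ (fun a => φ (σ s a)) (fun a => s • φ a) ≤ δ}

/-- A finite open cover. -/
def IsFinOpenCover {Y : Type*} [TopologicalSpace Y] (𝒰 : Finset (Set Y)) : Prop :=
  (∀ U ∈ 𝒰, IsOpen U) ∧ (⋃ U ∈ 𝒰, U) = Set.univ

/-- `𝒱` refines `𝒰`. -/
def Refines {Y : Type*} (𝒱 𝒰 : Finset (Set Y)) : Prop :=
  ∀ V ∈ 𝒱, ∃ U ∈ 𝒰, V ⊆ U

/-- `ord` of a finite family of sets: the maximal multiplicity minus one. -/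
noncomputable def coverOrd {Y : Type*} (𝒰 : Finset (Set Y)) : EReal :=
  (⨆ y : Y, (((𝒰.filter fun U => y ∈ U).card : ℝ) : EReal)) - 1

/-- `D(𝒰)`: the infimum of `ord 𝒱` over finite open covers `𝒱` refining `𝒰`. -/
noncomputable def coverD {Y : Type*} [TopologicalSpace Y] (𝒰 : Finset (Set Y)) : EReal :=
  ⨅ 𝒱 ∈ {𝒱 : Finset (Set Y) | IsFinOpenCover 𝒱 ∧ Refines 𝒱 𝒰}, coverOrd 𝒱

/-- the product cover `𝒰^d` of `Y^[d]`. -/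
noncomputable def prodCover {Y : Type*} (𝒰 : Finset (Set Y)) (d : ℕ) :
    Finset (Set (Fin d → Y)) :=
  (Fintype.piFinset fun _ : Fin d => 𝒰).image fun U => {φ | ∀ a, φ a ∈ U a}

/-- restriction of a cover to a subset, viewed as a cover of the subtype. -/
noncomputable def restrictCover {Y : Type*} (𝒰 : Finset (Set Y)) (Z : Set Y) :
    Finset (Set Z) :=
  𝒰.image fun U => (Subtype.val ⁻¹' U : Set Z)

/-- `D(𝒰, ρ, F, δ, σ)`. -/
noncomputable def coverDMap {G X : Type*} [Group G] [TopologicalSpace X] [MulAction G X]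
    (𝒰 : Finset (Set X)) (ρ : ContPseudoMetric X) (F : Finset G) (δ : ℝ) {d : ℕ}
    (σ : G → Equiv.Perm (Fin d)) : EReal :=
  coverD (restrictCover (prodCover 𝒰 d) (MapSpace ρ F δ σ))

/-- `D_Σ(𝒰, ρ, F, δ)`. -/
noncomputable def DSigmaFdel {G X : Type*} [Group G] [TopologicalSpace X] [MulAction G X]
    (Sap : SoficApprox G) (𝒰 : Finset (Set X)) (ρ : ContPseudoMetric X)
    (F : Finset G) (δ : ℝ) : EReal :=
  limsup (fun i => coverDMap 𝒰 ρ F δ (Sap.σ i) * ((Sap.d i : ℝ)⁻¹ : EReal)) atTop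

/-- `D_Σ(𝒰, ρ, F)`. -/
noncomputable def DSigmaF {G X : Type*} [Group G] [TopologicalSpace X] [MulAction G X]
    (Sap : SoficApprox G) (𝒰 : Finset (Set X)) (ρ : ContPseudoMetric X)
    (F : Finset G) : EReal :=
  ⨅ δ : {δ : ℝ // 0 < δ}, DSigmaFdel Sap 𝒰 ρ F δ.1

/-- `D_Σ(𝒰, ρ)`. -/
noncomputable def DSigmaU {G X : Type*} [Group G] [TopologicalSpace X] [MulAction G X]
    (Sap : SoficApprox G) (𝒰 : Finset (Set X)) (ρ : ContPseudoMetric X) : EReal :=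
  ⨅ F : {F : Finset G // F.Nonempty}, DSigmaF Sap 𝒰 ρ F.1

/-- the sofic mean topological dimension `mdim_Σ(X, ρ)`. -/
noncomputable def mdimSigma {G X : Type*} [Group G] [TopologicalSpace X] [MulAction G X]
    (Sap : SoficApprox G) (ρ : ContPseudoMetric X) : EReal :=
  ⨆ 𝒰 ∈ {𝒰 : Finset (Set X) | IsFinOpenCover 𝒰}, DSigmaU Sap 𝒰 ρ

/-- `N_ε(Y, ρ)`: the maximal cardinality of `ε`-separated subsets. -/
noncomputable def sepNum {Y : Type*} (ρ : Y → Y → ℝ) (ε : ℝ) : ℕ∞ :=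
  ⨆ E ∈ {E : Set Y | ∀ x ∈ E, ∀ y ∈ E, x ≠ y → ε ≤ ρ x y}, E.encard

/-- The extended-real logarithm of an extended natural number. -/
noncomputable def elog (n : ℕ∞) : EReal :=
  if n = ⊤ then ⊤ else if n = 0 then ⊥ else ((Real.log n.toNat : ℝ) : EReal)

/-- `log N_ε(Map(ρ,F,δ,σ), ρ_∞)`. -/
noncomputable def hCnt {G X : Type*} [Group G] [TopologicalSpace X] [MulAction G X]
    (ρ : ContPseudoMetric X) (F : Finset G) (δ : ℝ) {d : ℕ}
    (σ : G → Equiv.Perm (Fin d)) (ε : ℝ) : EReal :=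
  elog (sepNum (fun φ ψ : MapSpace ρ F δ σ => rhoInfty ρ φ.1 ψ.1) ε)

/-- `h^ε_{Σ,∞}(ρ, F, δ)`. -/
noncomputable def hEpsFdel {G X : Type*} [Group G] [TopologicalSpace X] [MulAction G X]
    (Sap : SoficApprox G) (ρ : ContPseudoMetric X) (ε : ℝ) (F : Finset G) (δ : ℝ) : EReal :=
  limsup (fun i => hCnt ρ F δ (Sap.σ i) ε * ((Sap.d i : ℝ)⁻¹ : EReal)) atTop

/-- `h^ε_{Σ,∞}(ρ)`. -/
noncomputable def hEps {G X : Type*} [Group G] [TopologicalSpace X] [MulAction G X]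
    (Sap : SoficApprox G) (ρ : ContPseudoMetric X) (ε : ℝ) : EReal :=
  ⨅ F : {F : Finset G // F.Nonempty}, ⨅ δ : {δ : ℝ // 0 < δ}, hEpsFdel Sap ρ ε F.1 δ.1

/-- The sofic mean metric dimension `mdim_{Σ,M}(X, ρ)`. -/
noncomputable def mdimSigmaM {G X : Type*} [Group G] [TopologicalSpace X] [MulAction G X]
    (Sap : SoficApprox G) (ρ : ContPseudoMetric X) : EReal :=
  liminf (fun ε : ℝ => hEps Sap ρ ε * ((|Real.log ε|⁻¹ : ℝ) : EReal)) (𝓝[>] (0 : ℝ))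

/-- The sofic mean metric dimension `mdim_{Σ,M}(X)`. -/
noncomputable def mdimSigmaMFull {G : Type*} [Group G] (Sap : SoficApprox G)
    (X : Type*) [TopologicalSpace X] [MulAction G X] : EReal :=
  ⨅ ρ : {ρ : ContPseudoMetric X // ρ.IsCompatMetric}, mdimSigmaM Sap ρ.1

/-- Følner-type characterization of amenability of a discrete group. -/
def AmenableF (G : Type*) [Group G] : Prop :=
  ∀ (K : Finset G) (ε : ℝ), 0 < ε →
    ∃ F : Finset G, F.Nonempty ∧ (((K * F) \ F).card : ℝ) < ε * F.card

/-- The set of `(K, ε)`-invariant nonempty finite subsets of `G`. -/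
noncomputable def FolnerSets {G : Type*} [Group G] (K : Finset G) (ε : ℝ) :
    Set (Finset G) :=
  {F | F.Nonempty ∧ (((K * F) \ F).card : ℝ) < ε * F.card}

/-- The cover `𝒰^F = ⋁_{s ∈ F} s⁻¹ 𝒰`. -/
noncomputable def coverJoin {G X : Type*} [Group G] [TopologicalSpace X] [MulAction G X]
    (𝒰 : Finset (Set X)) (F : Finset G) : Finset (Set X) :=
  (F.pi fun _ => 𝒰).image fun f => ⋂ s, ⋂ (h : s ∈ F), (fun x : X => s • x) ⁻¹' f s h

/-- `mdim(𝒰)` as an inf-sup over more and more invariant sets. -/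
noncomputable def mdimCoverIS {G X : Type*} [Group G] [TopologicalSpace X] [MulAction G X]
    (𝒰 : Finset (Set X)) : EReal :=
  ⨅ K : Finset G, ⨅ ε : {ε : ℝ // 0 < ε},
    ⨆ F ∈ FolnerSets K ε.1, coverD (coverJoin 𝒰 F) * ((F.card : ℝ)⁻¹ : EReal)

/-- `mdim(𝒰)` as a sup-inf over more and more invariant sets. -/
noncomputable def mdimCoverSI {G X : Type*} [Group G] [TopologicalSpace X] [MulAction G X]
    (𝒰 : Finset (Set X)) : EReal :=
  ⨆ K : Finset G, ⨆ ε : {ε : ℝ // 0 < ε},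
    ⨅ F ∈ FolnerSets K ε.1, coverD (coverJoin 𝒰 F) * ((F.card : ℝ)⁻¹ : EReal)

/-- mean topological dimension, inf-sup form. -/
noncomputable def mdimIS (G X : Type*) [Group G] [TopologicalSpace X] [MulAction G X] :
    EReal :=
  ⨆ 𝒰 ∈ {𝒰 : Finset (Set X) | IsFinOpenCover 𝒰}, mdimCoverIS (G := G) 𝒰

/-- mean topological dimension, sup-inf form. -/
noncomputable def mdimSI (G X : Type*) [Group G] [TopologicalSpace X] [MulAction G X] :
    EReal :=
  ⨆ 𝒰 ∈ {𝒰 : Finset (Set X) | IsFinOpenCover 𝒰}, mdimCoverSI (G := G) 𝒰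

/-- the pseudometric `ρ_F(x,y) = max_{s ∈ F} ρ(sx, sy)`. -/
noncomputable def rhoF {G X : Type*} [Group G] [TopologicalSpace X] [MulAction G X]
    (ρ : ContPseudoMetric X) (F : Finset G) (x y : X) : ℝ :=
  ⨆ s : F, ρ.d ((s : G) • x) ((s : G) • y)

/-- diameter of a set w.r.t. a pseudometric given as a function. -/
noncomputable def diamP {Y : Type*} (ρ : Y → Y → ℝ) (U : Set Y) : ℝ :=
  ⨆ x : U, ⨆ y : U, ρ x y

/-- mesh of a finite cover w.r.t. a pseudometric given as a function. -/
noncomputable def meshP {Y : Type*} (ρ : Y → Y → ℝ) (𝒰 : Finset (Set Y)) : ℝ :=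
  ⨆ U : 𝒰, diamP ρ U.1

/-- minimal cardinality of a finite open cover of mesh `< ε`. -/
noncomputable def minCoverCard {Y : Type*} [TopologicalSpace Y] (ρ : Y → Y → ℝ) (ε : ℝ) : ℕ :=
  sInf {n : ℕ | ∃ 𝒰 : Finset (Set Y), IsFinOpenCover 𝒰 ∧ meshP ρ 𝒰 < ε ∧ 𝒰.card = n}

/-- `S(X, ε, ρ)` in inf-sup form. -/
noncomputable def SamenIS {G X : Type*} [Group G] [TopologicalSpace X] [MulAction G X]
    (ρ : ContPseudoMetric X) (ε : ℝ) : EReal :=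
  ⨅ K : Finset G, ⨅ δ : {δ : ℝ // 0 < δ},
    ⨆ F ∈ FolnerSets K δ.1,
      ((Real.log (minCoverCard (rhoF ρ F) ε) / F.card : ℝ) : EReal)

/-- `S(X, ε, ρ)` in sup-inf form. -/
noncomputable def SamenSI {G X : Type*} [Group G] [TopologicalSpace X] [MulAction G X]
    (ρ : ContPseudoMetric X) (ε : ℝ) : EReal :=
  ⨆ K : Finset G, ⨆ δ : {δ : ℝ // 0 < δ},
    ⨅ F ∈ FolnerSets K δ.1,
      ((Real.log (minCoverCard (rhoF ρ F) ε) / F.card : ℝ) : EReal)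

/-- mean metric dimension `mdim_M(X, ρ)`, inf-sup form. -/
noncomputable def mdimMIS {G X : Type*} [Group G] [TopologicalSpace X] [MulAction G X]
    (ρ : ContPseudoMetric X) : EReal :=
  liminf (fun ε : ℝ => SamenIS (G := G) ρ ε * ((|Real.log ε|⁻¹ : ℝ) : EReal)) (𝓝[>] (0 : ℝ))

/-- mean metric dimension `mdim_M(X, ρ)`, sup-inf form. -/
noncomputable def mdimMSI {G X : Type*} [Group G] [TopologicalSpace X] [MulAction G X]
    (ρ : ContPseudoMetric X) : EReal :=
  liminf (fun ε : ℝ => SamenSI (G := G) ρ ε * ((|Real.log ε|⁻¹ : ℝ) : EReal)) (𝓝[>] (0 : ℝ))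

/-- The covering dimension of a topological space, as an extended natural number. -/
noncomputable def covDim (Y : Type*) [TopologicalSpace Y] : ℕ∞ :=
  sInf {n : ℕ∞ | ∀ 𝒰 : Finset (Set Y), IsFinOpenCover 𝒰 →
    ∃ 𝒱 : Finset (Set Y), IsFinOpenCover 𝒱 ∧ Refines 𝒱 𝒰 ∧
      ∀ y : Y, (((𝒱.filter fun V => y ∈ V).card : ℕ∞)) ≤ n + 1}

/-- conversion of extended naturals into extended reals. -/
noncomputable def enatToEReal (n : ℕ∞) : EReal :=
  if n = ⊤ then ⊤ else ((n.toNat : ℝ) : EReal)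

/-- The action of `G` on a `G`-invariant subset. -/
def invariantSubMulAction {G X : Type*} [Group G] [MulAction G X] (Y : Set X)
    (h : ∀ (s : G), ∀ x ∈ Y, s • x ∈ Y) : MulAction G Y where
  smul s y := ⟨s • (y : X), h s y y.2⟩
  one_smul y := Subtype.ext (one_smul G (y : X))
  mul_smul s t y := Subtype.ext (mul_smul s t (y : X))

end SoficMD


open Filter Topology TopologicalSpace
open scoped ENat
open scoped Classical Pointwise

namespace SoficMD

/-- The values of a partition of unity with at most `k + 1` nonzero terms: one of them is at least
`1 / (k + 1)`. -/
theorem exists_one_div_le_of_sum_eq_one {α : Type*} [Fintype α] {f : α → ℝ} {k : ℕ}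
    (hsum : ∑ a, f a = 1) (hk : (Finset.univ.filter fun a => f a ≠ 0).card ≤ k + 1) :
    ∃ a, 1 / ((k : ℝ) + 1) ≤ f a := by
  by_contra! h
  rw [← Finset.sum_filter_ne_zero] at hsum
  have hne : (Finset.univ.filter fun a => f a ≠ 0).Nonempty := by
    rw [Finset.nonempty_iff_ne_empty]
    intro h0
    simp [h0] at hsum
  have hlt := Finset.sum_lt_sum_of_nonempty hne fun a _ => h a
  rw [hsum, Finset.sum_const, nsmul_eq_mul] at hlt
  have hk' : ((Finset.univ.filter fun a => f a ≠ 0).card : ℝ) ≤ k + 1 := by exact_mod_cast hk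
  have hpos : (0 : ℝ) < k + 1 := by positivity
  have := mul_le_mul_of_nonneg_right hk' (one_div_pos.2 hpos).le
  rw [mul_one_div_cancel hpos.ne'] at this
  linarith

/-- At most `k` of the thresholds `t j ∈ (0, 1 / (k + 1))` are values of a family of numbers with
sum one and at most `k + 1` nonzero terms. -/
theorem card_thresholds_hit_le {α β : Type*} [Fintype α] [Fintype β] {f : α → ℝ} {k : ℕ}
    (hsum : ∑ a, f a = 1) (hk : (Finset.univ.filter fun a => f a ≠ 0).card ≤ k + 1)
    {t : β → ℝ} (ht : Function.Injective t) (ht0 : ∀ j, 0 < t j)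
    (ht1 : ∀ j, t j < 1 / ((k : ℝ) + 1)) :
    (Finset.univ.filter fun j => ∃ a, f a = t j).card ≤ k := by
  obtain ⟨a₀, ha₀⟩ := exists_one_div_le_of_sum_eq_one hsum hk
  have hex : ∀ j ∈ Finset.univ.filter fun j => ∃ a, f a = t j, ∃ a, f a = t j := by simp
  have : Nonempty α := ⟨a₀⟩
  choose! g hg using hex
  have hcard : ((Finset.univ.filter fun a => f a ≠ 0).erase a₀).card ≤ k := by
    rw [Finset.card_erase_of_mem]
    · omega
    · have : (0 : ℝ) < 1 / ((k : ℝ) + 1) := by positivity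
      simpa using (this.trans_le ha₀).ne'
  refine le_trans (Finset.card_le_card_of_injOn g (fun j hj => ?_) fun i hi j hj hij => ?_) hcard
  · have h := hg j hj
    simp only [Finset.coe_erase, Finset.coe_filter, Finset.mem_univ, true_and, Set.mem_sdiff,
      Set.mem_ofPred_eq, Set.mem_singleton_iff]
    refine ⟨by rw [h]; exact (ht0 j).ne', fun h' => ?_⟩
    rw [h'] at h
    linarith [ht1 j]
  · apply ht
    rw [← hg i hi, ← hg j hj, hij]

/-- Subadditivity of the order for joins of finite open covers of a normal space: the join of open
covers `V n` of multiplicity at most `k n + 1` has a refinement of multiplicity at most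
`∑ n, k n + 1`. -/
theorem exists_refinement_of_join {Y ι : Type*} [TopologicalSpace Y] [NormalSpace Y] [Fintype ι]
    {α : ι → Type*} [∀ n, Fintype (α n)] (V : ∀ n, α n → Set Y)
    (hV : ∀ n a, IsOpen (V n a)) (hcov : ∀ n, (⋃ a, V n a) = Set.univ) (k : ι → ℕ)
    (hk : ∀ n y, (Finset.univ.filter fun a => y ∈ V n a).card ≤ k n + 1) :
    ∃ 𝒲 : Finset (Set Y), IsFinOpenCover 𝒲 ∧
      (∀ W ∈ 𝒲, W.Nonempty ∧ ∃ c : ∀ n, α n, W ⊆ ⋂ n, V n (c n)) ∧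
      ∀ y, (𝒲.filter fun W => y ∈ W).card ≤ (∑ n, k n) + 1 := by
  have hpart : ∀ n, ∃ f : PartitionOfUnity (α n) Y Set.univ, f.IsSubordinate (V n) := fun n =>
    PartitionOfUnity.exists_isSubordinate_of_locallyFinite isClosed_univ (V n) (hV n)
      (locallyFinite_of_finite _) (hcov n).ge
  choose f hf using hpart
  have hfV : ∀ n a y, f n a y ≠ 0 → y ∈ V n a := fun n a y h =>
    hf n a (subset_tsupport _ h)
  have hsum : ∀ n y, ∑ a, f n a y = 1 := fun n y => by
    rw [← finsum_eq_sum_of_fintype]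
    exact (f n).sum_eq_one (Set.mem_univ y)
  have hcard : ∀ n y, (Finset.univ.filter fun a => f n a y ≠ 0).card ≤ k n + 1 := fun n y =>
    (Finset.card_le_card (Finset.monotone_filter_right _ fun a _ => hfV n a y)).trans (hk n y)
  let t : ι → Fin ((∑ n, k n) + 1) → ℝ := fun n j => 1 / ((k n : ℝ) + 2 + (j : ℕ))
  have ht0 : ∀ n j, 0 < t n j := fun n j => by positivity
  have ht1 : ∀ n j, t n j < 1 / ((k n : ℝ) + 1) := fun n j =>
    one_div_lt_one_div_of_lt (by positivity)
      (by have : (0 : ℝ) ≤ (j : ℕ) := Nat.cast_nonneg _; linarith)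
  have htinj : ∀ n, Function.Injective (t n) := fun n i j hij => by
    have h : ((k n : ℝ) + 2 + (i : ℕ)) = (k n : ℝ) + 2 + (j : ℕ) := by
      simpa [t] using hij
    have h' : ((i : ℕ) : ℝ) = (j : ℕ) := by linarith
    exact Fin.ext (by exact_mod_cast h')
  let level : Fin ((∑ n, k n) + 1) → Y → ∀ n, Finset (α n) := fun j y n =>
    Finset.univ.filter fun a => t n j < f n a y
  let Z : Fin ((∑ n, k n) + 1) → (∀ n, Finset (α n)) → Set Y := fun j A =>
    ⋂ n, ⋂ a, if a ∈ A n then {y | t n j < f n a y} else {y | f n a y < t n j}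
  have hZlevel : ∀ j A y, y ∈ Z j A → A = level j y := by
    intro j A y hy
    funext n
    ext a
    have h := Set.mem_iInter.1 (Set.mem_iInter.1 hy n) a
    by_cases ha : a ∈ A n
    · simpa [ha, level] using h
    · simp only [ha, if_false, Set.mem_ofPred_eq] at h
      simpa [ha, level] using h.le
  have hZopen : ∀ j A, IsOpen (Z j A) := fun j A =>
    isOpen_iInter_of_finite fun n => isOpen_iInter_of_finite fun a => by
      split_ifs
      · exact isOpen_lt continuous_const (f n a).continuous
      · exact isOpen_lt (f n a).continuous continuous_const
  have hgood : ∀ y, ∃ j, ∀ n a, f n a y ≠ t n j := by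
    intro y
    by_contra! hbad
    have hsub : (Finset.univ : Finset (Fin ((∑ n, k n) + 1))) ⊆
        Finset.univ.biUnion fun n => Finset.univ.filter fun j => ∃ a, f n a y = t n j := by
      intro j _
      simpa using hbad j
    have h := (Finset.card_le_card hsub).trans Finset.card_biUnion_le
    have h' := h.trans (Finset.sum_le_sum fun n _ =>
      card_thresholds_hit_le (hsum n y) (hcard n y) (htinj n) (ht0 n) (ht1 n))
    simp at h'
  refine ⟨(Finset.univ.image fun p : Fin ((∑ n, k n) + 1) × (∀ n, Finset (α n)) =>
    Z p.1 p.2).filter Set.Nonempty, ⟨fun U hU => ?_, ?_⟩, fun W hW => ?_, fun y => ?_⟩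
  · simp only [Finset.mem_filter, Finset.mem_image, Finset.mem_univ, true_and] at hU
    obtain ⟨⟨p, rfl⟩, -⟩ := hU
    exact hZopen _ _
  · refine Set.eq_univ_of_forall fun y => ?_
    obtain ⟨j, hj⟩ := hgood y
    have hy : y ∈ Z j (level j y) := by
      refine Set.mem_iInter.2 fun n => Set.mem_iInter.2 fun a => ?_
      by_cases ha : t n j < f n a y
      · simp [level, ha]
      · simpa [level, ha] using lt_of_le_of_ne (not_lt.1 ha) (hj n a)
    simp only [Set.mem_iUnion]
    refine ⟨Z j (level j y), ?_, hy⟩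
    simp only [Finset.mem_filter, Finset.mem_image, Finset.mem_univ, true_and]
    exact ⟨⟨(j, level j y), rfl⟩, y, hy⟩
  · simp only [Finset.mem_filter, Finset.mem_image, Finset.mem_univ, true_and] at hW
    obtain ⟨⟨⟨j, A⟩, rfl⟩, y, hy⟩ := hW
    refine ⟨⟨y, hy⟩, ?_⟩
    have hA : ∀ n, ∃ a, a ∈ A n := fun n => by
      obtain ⟨a, ha⟩ := exists_one_div_le_of_sum_eq_one (hsum n y) (hcard n y)
      refine ⟨a, ?_⟩
      rw [hZlevel j A y hy]
      simpa [level] using (ht1 n j).trans_le ha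
    choose c hc using hA
    refine ⟨c, fun z hz => Set.mem_iInter.2 fun n => hfV _ _ _ ?_⟩
    have h := Set.mem_iInter.1 (Set.mem_iInter.1 hz n) (c n)
    simp only [hc, if_true, Set.mem_ofPred_eq] at h
    exact ((ht0 n j).trans h).ne'
  · have hsub : ((Finset.univ.image fun p : Fin ((∑ n, k n) + 1) × (∀ n, Finset (α n)) =>
        Z p.1 p.2).filter Set.Nonempty).filter (fun W => y ∈ W) ⊆
        Finset.univ.image fun j => Z j (level j y) := by
      intro W hW
      simp only [Finset.mem_filter, Finset.mem_image, Finset.mem_univ, true_and] at hW ⊢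
      obtain ⟨⟨⟨⟨j, A⟩, rfl⟩, -⟩, hy⟩ := hW
      exact ⟨j, by rw [← hZlevel j A y hy]⟩
    exact (Finset.card_le_card hsub).trans (Finset.card_image_le.trans (by simp))

theorem IsFinOpenCover.iUnion_coe {Y : Type*} [TopologicalSpace Y] {𝒱 : Finset (Set Y)}
    (h : IsFinOpenCover 𝒱) : (⋃ V : 𝒱, (V : Set Y)) = Set.univ := by
  rw [← h.2]
  ext y
  simp

theorem pseudoMetrizableSpace_pi_of_countable {ι : Type*} [Countable ι] (X : ι → Type*)
    [∀ n, TopologicalSpace (X n)] [∀ n, MetrizableSpace (X n)] :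
    PseudoMetrizableSpace (∀ n, X n) := by
  let : ∀ n, MetricSpace (X n) := fun n => metrizableSpaceMetric (X n)
  infer_instance

theorem coverOrd_le {Y : Type*} {𝒱 : Finset (Set Y)} {k : ℕ}
    (h : ∀ y, (𝒱.filter fun V => y ∈ V).card ≤ k + 1) : coverOrd 𝒱 ≤ ((k : ℝ) : EReal) := by
  have h1 : (⨆ y : Y, (((𝒱.filter fun U => y ∈ U).card : ℝ) : EReal)) ≤
      (((k : ℝ) + 1 : ℝ) : EReal) :=
    iSup_le fun y => EReal.coe_le_coe_iff.2 (by exact_mod_cast h y)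
  refine (EReal.sub_le_sub h1 le_rfl).trans (le_of_eq ?_)
  rw [← EReal.coe_one, ← EReal.coe_sub]
  simp

/-- A finite cover of a nonempty space has a natural number as its order. -/
theorem exists_nat_le_coverOrd {Y : Type*} [TopologicalSpace Y] [Nonempty Y] {𝒱 : Finset (Set Y)}
    (h𝒱 : IsFinOpenCover 𝒱) :
    ∃ k : ℕ, (∀ y, (𝒱.filter fun V => y ∈ V).card ≤ k + 1) ∧ ((k : ℝ) : EReal) ≤ coverOrd 𝒱 := by
  have hfin : (Set.range fun y : Y => (𝒱.filter fun V => y ∈ V).card).Finite :=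
    (Set.finite_Iic 𝒱.card).subset (by rintro _ ⟨y, rfl⟩; exact Finset.card_filter_le _ _)
  obtain ⟨_, ⟨y, rfl⟩, hy⟩ := Set.exists_max_image _ id hfin (Set.range_nonempty _)
  have hpos : 0 < (𝒱.filter fun V => y ∈ V).card := by
    have hmem : y ∈ ⋃ U ∈ 𝒱, U := h𝒱.2 ▸ Set.mem_univ y
    simp only [Set.mem_iUnion] at hmem
    obtain ⟨U, hU, hyU⟩ := hmem
    exact Finset.card_pos.2 ⟨U, Finset.mem_filter.2 ⟨hU, hyU⟩⟩
  refine ⟨(𝒱.filter fun V => y ∈ V).card - 1, fun z => ?_, ?_⟩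
  · have := hy _ ⟨z, rfl⟩
    simp only [id] at this
    omega
  · have h1 : (((𝒱.filter fun U => y ∈ U).card : ℝ) : EReal) ≤
        ⨆ y : Y, (((𝒱.filter fun U => y ∈ U).card : ℝ) : EReal) :=
      le_iSup (fun y : Y => (((𝒱.filter fun U => y ∈ U).card : ℝ) : EReal)) y
    refine le_trans (le_of_eq ?_) (EReal.sub_le_sub h1 le_rfl)
    rw [← EReal.coe_one, ← EReal.coe_sub]
    simp [Nat.cast_sub (Nat.succ_le_of_lt hpos)]

theorem coverD_of_isEmpty {Y : Type*} [TopologicalSpace Y] [IsEmpty Y] (𝒰 : Finset (Set Y)) :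
    coverD 𝒰 = ⊥ := by
  have hcov : IsFinOpenCover (∅ : Finset (Set Y)) :=
    ⟨by simp, Set.eq_univ_of_forall fun y => isEmptyElim y⟩
  refine le_bot_iff.1 ((iInf₂_le (∅ : Finset (Set Y)) ⟨hcov, by simp [Refines]⟩).trans ?_)
  simp [coverOrd]

theorem coverD_nonneg {Y : Type*} [TopologicalSpace Y] [Nonempty Y] (𝒰 : Finset (Set Y)) :
    0 ≤ coverD 𝒰 := by
  refine le_iInf₂ fun 𝒱 h𝒱 => ?_
  obtain ⟨k, -, hk⟩ := exists_nat_le_coverOrd h𝒱.1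
  exact le_trans (by exact_mod_cast k.cast_nonneg) hk

theorem mem_restrictCover_prodCover {Y : Type*} {𝒰 : Finset (Set Y)} {d : ℕ}
    {Z : Set (Fin d → Y)} {U : Set Z} :
    U ∈ restrictCover (prodCover 𝒰 d) Z ↔
      ∃ u : Fin d → Set Y, (∀ a, u a ∈ 𝒰) ∧ {φ : Z | ∀ a, φ.1 a ∈ u a} = U := by
  simp only [restrictCover, prodCover, Finset.mem_image, Fintype.mem_piFinset,
    exists_exists_and_eq_and]
  rfl

/-- A finite open cover of a product of compact spaces is refined by a product of finitely many
finite open covers of the factors. -/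
theorem exists_box_refinement {ι : Type*} (X : ι → Type*)
    [∀ n, TopologicalSpace (X n)] [∀ n, CompactSpace (X n)] [∀ n, MetrizableSpace (X n)]
    {𝒰 : Finset (Set (∀ n, X n))} (h𝒰 : IsFinOpenCover 𝒰) :
    ∃ (S : Finset ι) (𝒱 : ∀ n, Finset (Set (X n))), (∀ n, IsFinOpenCover (𝒱 n)) ∧
      ∀ v : ∀ n, Set (X n), (∀ n ∈ S, v n ∈ 𝒱 n) → (∃ x : ∀ n, X n, ∀ n ∈ S, x n ∈ v n) →
        ∃ U ∈ 𝒰, {x : ∀ n, X n | ∀ n ∈ S, x n ∈ v n} ⊆ U := by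
  let : ∀ n, MetricSpace (X n) := fun n => metrizableSpaceMetric (X n)
  obtain ⟨V, hV, hVU⟩ := lebesgue_number_lemma (K := (Set.univ : Set (∀ n, X n)))
    (U := fun U : 𝒰 => U.1) isCompact_univ (fun U => h𝒰.1 _ U.2)
    h𝒰.iUnion_coe.ge
  rw [Pi.uniformity, Filter.mem_iInf'] at hV
  obtain ⟨I, hI, W, hW, -, hVW, -⟩ := hV
  have hr : ∀ n, ∃ r > 0, ∀ x y : ∀ n, X n, dist (x n) (y n) < r → (x, y) ∈ W n := fun n => by
    obtain ⟨T, hT, hTW⟩ := hW n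
    obtain ⟨r, hr, hrT⟩ := Metric.mem_uniformity_dist.1 hT
    exact ⟨r, hr, fun x y hxy => hTW (hrT hxy)⟩
  choose r hr hrW using hr
  have hcover : ∀ n, ∃ 𝒱 : Finset (Set (X n)), IsFinOpenCover 𝒱 ∧
      ∀ v ∈ 𝒱, ∀ x ∈ v, ∀ y ∈ v, dist x y < r n := fun n => by
    obtain ⟨t, -, ht, htc⟩ := finite_cover_balls_of_compact
      (isCompact_univ (X := X n)) (half_pos (hr n))
    refine ⟨ht.toFinset.image fun x => Metric.ball x (r n / 2), ⟨by simp, ?_⟩, ?_⟩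
    · simpa [Set.univ_subset_iff] using htc
    · simp only [Finset.mem_image, Set.Finite.mem_toFinset]
      rintro _ ⟨z, -, rfl⟩ x hx y hy
      have := dist_triangle_right x y z
      rw [Metric.mem_ball] at hx hy
      linarith
  choose 𝒱 h𝒱 hdiam using hcover
  refine ⟨hI.toFinset, 𝒱, h𝒱, fun v hv ⟨x, hx⟩ => ?_⟩
  obtain ⟨U, hU⟩ := hVU x (Set.mem_univ x)
  refine ⟨U, U.2, fun y hy => hU ?_⟩
  change (x, y) ∈ V
  rw [hVW]
  refine Set.mem_iInter₂.2 fun n hn => hrW n x y ?_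
  have hn' : n ∈ hI.toFinset := by simpa using hn
  exact hdiam n (v n) (hv n hn') _ (hx n hn') _ (hy n hn')

theorem coverDMap_pi_le {G : Type*} [Group G] {ι : Type*} [Countable ι] (X : ι → Type*)
    [∀ n, TopologicalSpace (X n)] [∀ n, MetrizableSpace (X n)] [∀ n, MulAction G (X n)]
    (ρ : ∀ n, ContPseudoMetric (X n)) (ρP : ContPseudoMetric (∀ n, X n))
    {𝒰 : Finset (Set (∀ n, X n))} (S : Finset ι) (𝒱 : ∀ n, Finset (Set (X n)))
    (hbox : ∀ v : ∀ n, Set (X n), (∀ n ∈ S, v n ∈ 𝒱 n) → (∃ x : ∀ n, X n, ∀ n ∈ S, x n ∈ v n) →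
        ∃ U ∈ 𝒰, {x : ∀ n, X n | ∀ n ∈ S, x n ∈ v n} ⊆ U)
    {d : ℕ} {σ : G → Equiv.Perm (Fin d)} (F : Finset G) (δ : ℝ) (E : ι → Finset G) (η : ι → ℝ)
    (hproj : ∀ n ∈ S, ∀ φ ∈ MapSpace ρP F δ σ, (fun a => φ a n) ∈ MapSpace (ρ n) (E n) (η n) σ)
    (c : ι → ℝ) (hc : ∀ n ∈ S, coverDMap (𝒱 n) (ρ n) (E n) (η n) σ < c n) :
    coverDMap 𝒰 ρP F δ σ ≤ ((∑ n ∈ S, c n : ℝ) : EReal) := by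
  rcases isEmpty_or_nonempty (MapSpace ρP F δ σ) with hY | ⟨⟨φ₀, hφ₀⟩⟩
  · rw [coverDMap, coverD_of_isEmpty]
    exact bot_le
  let π : ∀ n : S, MapSpace ρP F δ σ → MapSpace (ρ n) (E n) (η n) σ := fun n φ =>
    ⟨fun a => φ.1 a n, hproj n n.2 φ.1 φ.2⟩
  have hπ : ∀ n, Continuous (π n) := fun n => by
    refine Continuous.subtype_mk (continuous_pi fun a => ?_) _
    exact (continuous_apply n.1).comp ((continuous_apply a).comp continuous_subtype_val)
  have hex : ∀ n : S, ∃ (𝒲 : Finset (Set (MapSpace (ρ n) (E n) (η n) σ))) (k : ℕ),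
      IsFinOpenCover 𝒲 ∧ Refines 𝒲 (restrictCover (prodCover (𝒱 n) d) _) ∧
      (∀ y, (𝒲.filter fun W => y ∈ W).card ≤ k + 1) ∧ (k : ℝ) ≤ c n := fun n => by
    have h := hc n n.2
    simp only [coverDMap, coverD, iInf_lt_iff] at h
    obtain ⟨𝒲, ⟨h𝒲, hr⟩, hlt⟩ := h
    have : Nonempty (MapSpace (ρ n) (E n) (η n) σ) := ⟨π n ⟨φ₀, hφ₀⟩⟩
    obtain ⟨k, hk, hk'⟩ := exists_nat_le_coverOrd h𝒲
    exact ⟨𝒲, k, h𝒲, hr, hk, EReal.coe_le_coe_iff.1 (hk'.trans hlt.le)⟩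
  choose 𝒲 k h𝒲 href hk hkc using hex
  have := pseudoMetrizableSpace_pi_of_countable X
  let := pseudoMetrizableSpacePseudoMetric (MapSpace ρP F δ σ)
  obtain ⟨𝒵, h𝒵, hsub, hord⟩ := exists_refinement_of_join
    (Y := MapSpace ρP F δ σ) (ι := S) (α := fun n => 𝒲 n)
    (fun n W => π n ⁻¹' W.1) (fun n W => ((h𝒲 n).1 W.1 W.2).preimage (hπ n))
    (fun n => by rw [← Set.preimage_iUnion, (h𝒲 n).iUnion_coe, Set.preimage_univ])
    k (fun n y => by
      refine le_trans (Finset.card_le_card_of_injOn (fun W => W.1) (fun W hW => ?_)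
        Subtype.val_injective.injOn) (hk n (π n y))
      simpa using hW)
  have h𝒵ref : Refines 𝒵 (restrictCover (prodCover 𝒰 d) (MapSpace ρP F δ σ)) := fun Z hZ => by
    obtain ⟨⟨φ, hφ⟩, w, hw⟩ := hsub Z hZ
    have hu : ∀ n : S, ∃ u : Fin d → Set (X n), (∀ a, u a ∈ 𝒱 n) ∧
        ∀ ψ ∈ (w n).1, ∀ a, ψ.1 a ∈ u a := fun n => by
      obtain ⟨U, hU, hwU⟩ := href n (w n).1 (w n).2
      obtain ⟨u, hu, rfl⟩ := mem_restrictCover_prodCover.1 hU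
      exact ⟨u, hu, fun ψ hψ => hwU hψ⟩
    choose u hu𝒱 hwu using hu
    have hZu : ∀ ψ ∈ Z, ∀ (n : S) a, ψ.1 a n ∈ u n a := fun ψ hψ n a =>
      hwu n (π n ψ) (Set.mem_iInter.1 (hw hψ) n) a
    have hU : ∀ a, ∃ U ∈ 𝒰, ∀ x : ∀ n, X n, (∀ n : S, x n ∈ u n a) → x ∈ U := fun a => by
      obtain ⟨U, hU, hsubU⟩ := hbox (fun n => if h : n ∈ S then u ⟨n, h⟩ a else Set.univ)
        (fun n hn => by simpa [hn] using hu𝒱 ⟨n, hn⟩ a)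
        ⟨φ.1 a, fun n hn => by simpa [hn] using hZu φ hφ ⟨n, hn⟩ a⟩
      exact ⟨U, hU, fun x hx => hsubU fun n hn => by simpa [hn] using hx ⟨n, hn⟩⟩
    choose U hU hUsub using hU
    refine ⟨_, mem_restrictCover_prodCover.2 ⟨U, hU, rfl⟩, fun ψ hψ a => ?_⟩
    exact hUsub a _ fun n => hZu ψ hψ n a
  refine (iInf₂_le 𝒵 ⟨h𝒵, h𝒵ref⟩).trans ((coverOrd_le hord).trans ?_)
  rw [EReal.coe_le_coe_iff, ← Finset.sum_coe_sort S]
  push_cast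
  exact Finset.sum_le_sum fun n _ => hkc n

theorem MapSpace_subset {G X : Type*} [Group G] [TopologicalSpace X] [MulAction G X]
    (ρ : ContPseudoMetric X) {E F : Finset G} (hEF : E ⊆ F) {δ δ' : ℝ} (hδ : δ ≤ δ') {d : ℕ}
    (σ : G → Equiv.Perm (Fin d)) : MapSpace ρ F δ σ ⊆ MapSpace ρ E δ' σ :=
  fun _ hφ s hs => (hφ s (hEF hs)).trans hδ

/-- A continuous pseudometric pulled back to a compact space is controlled by a compatible metric,
up to a small additive error. -/
theorem exists_sq_le_add_mul_sq {P X : Type*} [TopologicalSpace P] [CompactSpace P]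
    [TopologicalSpace X] (ρP : ContPseudoMetric P) (hρP : ρP.IsCompatMetric)
    (ρ : ContPseudoMetric X) {π : P → X} (hπ : Continuous π) {ε : ℝ} (hε : 0 < ε) :
    ∃ C : ℝ, 0 ≤ C ∧ ∀ x y, ρ.d (π x) (π y) ^ 2 ≤ ε + C * ρP.d x y ^ 2 := by
  have hcont : Continuous fun p : P × P => ρ.d (π p.1) (π p.2) ^ 2 :=
    (ρ.continuous'.comp ((hπ.comp continuous_fst).prodMk (hπ.comp continuous_snd))).pow 2
  have hcontP : Continuous fun p : P × P => ρP.d p.1 p.2 ^ 2 := ρP.continuous'.pow 2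
  let K : Set (P × P) := {p | ε ≤ ρ.d (π p.1) (π p.2) ^ 2}
  have hK : IsCompact K := (isClosed_le continuous_const hcont).isCompact
  have hpos : ∀ p ∈ K, 0 < ρP.d p.1 p.2 ^ 2 := fun p hp => by
    refine pow_pos (lt_of_le_of_ne (ρP.nonneg _ _) fun h => ?_) 2
    have hp' : ε ≤ ρ.d (π p.1) (π p.2) ^ 2 := hp
    rw [hρP _ _ h.symm, ρ.refl] at hp'
    norm_num at hp'
    linarith
  obtain ⟨C, hC⟩ := hK.bddAbove_image (f := fun p : P × P =>
    ρ.d (π p.1) (π p.2) ^ 2 / ρP.d p.1 p.2 ^ 2)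
    (hcont.continuousOn.div hcontP.continuousOn fun p hp => (hpos p hp).ne')
  refine ⟨max C 0, le_max_right _ _, fun x y => ?_⟩
  by_cases hxy : (x, y) ∈ K
  · have h1 := hC (Set.mem_image_of_mem _ hxy)
    have h2 := (div_le_iff₀ (hpos _ hxy)).1 (h1.trans (le_max_left C 0))
    simp only at h2
    linarith
  · have h1 : ρ.d (π x) (π y) ^ 2 < ε := not_le.1 hxy
    have h2 : 0 ≤ max C 0 * ρP.d x y ^ 2 := mul_nonneg (le_max_right _ _) (sq_nonneg _)
    linarith

/-- Equivariant continuous maps send sufficiently equivariant maps to approximately equivariant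
maps. -/
theorem exists_comp_mem_MapSpace {G P X : Type*} [Group G] [TopologicalSpace P] [CompactSpace P]
    [TopologicalSpace X] [MulAction G P] [MulAction G X] (ρP : ContPseudoMetric P)
    (hρP : ρP.IsCompatMetric) (ρ : ContPseudoMetric X) {π : P → X} (hπ : Continuous π)
    (heq : Equivariant G π) {η : ℝ} (hη : 0 < η) :
    ∃ δ > 0, ∀ (F : Finset G) (d : ℕ) (σ : G → Equiv.Perm (Fin d)),
      ∀ φ ∈ MapSpace ρP F δ σ, (fun a => π (φ a)) ∈ MapSpace ρ F η σ := by
  have hη2 : 0 < η ^ 2 / 2 := by positivity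
  obtain ⟨C, hC0, hC⟩ := exists_sq_le_add_mul_sq ρP hρP ρ hπ hη2
  have hpos : 0 < η ^ 2 / 2 / (C + 1) := by positivity
  refine ⟨Real.sqrt (η ^ 2 / 2 / (C + 1)), Real.sqrt_pos.2 hpos, fun F d σ φ hφ s hs => ?_⟩
  have h := hφ s hs
  rw [rho2, Real.sqrt_le_sqrt_iff hpos.le] at h
  rw [rho2]
  refine Real.sqrt_le_iff.2 ⟨hη.le, ?_⟩
  have hterm : ∀ a, ρ.d (π (φ (σ s a))) (s • π (φ a)) ^ 2 ≤
      η ^ 2 / 2 + C * ρP.d (φ (σ s a)) (s • φ a) ^ 2 := fun a => by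
    rw [← heq]
    exact hC _ _
  have hd : 1 / (d : ℝ) * d ≤ 1 := by
    rw [one_div]
    exact inv_mul_le_one
  calc 1 / (d : ℝ) * ∑ a, ρ.d (π (φ (σ s a))) (s • π (φ a)) ^ 2
      ≤ 1 / (d : ℝ) * ∑ a, (η ^ 2 / 2 + C * ρP.d (φ (σ s a)) (s • φ a) ^ 2) :=
        mul_le_mul_of_nonneg_left (Finset.sum_le_sum fun a _ => hterm a) (by positivity)
    _ = 1 / (d : ℝ) * d * (η ^ 2 / 2) +
          C * (1 / (d : ℝ) * ∑ a, ρP.d (φ (σ s a)) (s • φ a) ^ 2) := by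
        rw [Finset.sum_add_distrib, ← Finset.mul_sum]
        simp only [Finset.sum_const, Finset.card_univ, Fintype.card_fin, nsmul_eq_mul]
        ring
    _ ≤ 1 * (η ^ 2 / 2) + (C + 1) * (η ^ 2 / 2 / (C + 1)) := by
        refine add_le_add (mul_le_mul_of_nonneg_right hd hη2.le) ?_
        exact mul_le_mul (by linarith) h (by positivity) (by linarith)
    _ = η ^ 2 := by
        rw [mul_div_cancel₀ _ (by positivity)]
        ring

theorem coe_natCast_pos {d : ℕ} (hd : 0 < d) : (0 : EReal) < ((d : ℝ) : EReal) := by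
  exact_mod_cast hd

theorem DSigmaU_le_of_eventually {G X : Type*} [Group G] [TopologicalSpace X] [MulAction G X]
    (Sap : SoficApprox G) {𝒰 : Finset (Set X)} {ρ : ContPseudoMetric X} {F : Finset G}
    (hF : F.Nonempty) {δ : ℝ} (hδ : 0 < δ) {c : EReal}
    (h : ∀ᶠ i in atTop, coverDMap 𝒰 ρ F δ (Sap.σ i) * ((Sap.d i : ℝ)⁻¹ : EReal) ≤ c) :
    DSigmaU Sap 𝒰 ρ ≤ c :=
  (iInf_le _ (⟨F, hF⟩ : {F : Finset G // F.Nonempty})).trans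
    ((iInf_le _ (⟨δ, hδ⟩ : {δ : ℝ // 0 < δ})).trans (limsup_le_of_le (by isBoundedDefault) h))

theorem exists_eventually_of_DSigmaU_lt {G X : Type*} [Group G] [TopologicalSpace X]
    [MulAction G X] (Sap : SoficApprox G) {𝒰 : Finset (Set X)} {ρ : ContPseudoMetric X}
    {c : ℝ} (h : DSigmaU Sap 𝒰 ρ < c) :
    ∃ (F : Finset G) (δ : ℝ), F.Nonempty ∧ 0 < δ ∧
      ∀ᶠ i in atTop, coverDMap 𝒰 ρ F δ (Sap.σ i) < ((c * (Sap.d i : ℝ) : ℝ) : EReal) := by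
  simp only [DSigmaU, DSigmaF, iInf_lt_iff] at h
  obtain ⟨⟨F, hF⟩, ⟨δ, hδ⟩, hlt⟩ := h
  refine ⟨F, δ, hF, hδ, ?_⟩
  filter_upwards [eventually_lt_of_limsup_lt hlt, Sap.d_tendsto.eventually_gt_atTop 0] with i hi hd
  rw [← div_eq_mul_inv, EReal.div_lt_iff (coe_natCast_pos hd) (EReal.coe_ne_top _)] at hi
  rwa [EReal.coe_mul]

theorem IsFinOpenCover.singleton_univ (Y : Type*) [TopologicalSpace Y] :
    IsFinOpenCover ({Set.univ} : Finset (Set Y)) := by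
  simp [IsFinOpenCover]

theorem DSigmaU_le_mdimSigma {G X : Type*} [Group G] [TopologicalSpace X] [MulAction G X]
    (Sap : SoficApprox G) {𝒰 : Finset (Set X)} (h𝒰 : IsFinOpenCover 𝒰) (ρ : ContPseudoMetric X) :
    DSigmaU Sap 𝒰 ρ ≤ mdimSigma Sap ρ :=
  le_iSup₂ (f := fun (𝒰 : Finset (Set X)) (_ : 𝒰 ∈ {𝒰 : Finset (Set X) | IsFinOpenCover 𝒰}) =>
    DSigmaU Sap 𝒰 ρ) 𝒰 h𝒰

/-- If the sofic mean topological dimension is `-∞`, then there are eventually no approximately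
equivariant maps. -/
theorem exists_eventually_isEmpty_MapSpace {G X : Type*} [Group G] [TopologicalSpace X]
    [MulAction G X] (Sap : SoficApprox G) {ρ : ContPseudoMetric X} (h : mdimSigma Sap ρ = ⊥) :
    ∃ (F : Finset G) (δ : ℝ), F.Nonempty ∧ 0 < δ ∧
      ∀ᶠ i in atTop, IsEmpty (MapSpace ρ F δ (Sap.σ i)) := by
  have hlt : DSigmaU Sap {Set.univ} ρ < ((0 : ℝ) : EReal) :=
    ((DSigmaU_le_mdimSigma Sap (IsFinOpenCover.singleton_univ X) ρ).trans h.le).trans_lt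
      (EReal.bot_lt_coe 0)
  obtain ⟨F, δ, hF, hδ, hev⟩ := exists_eventually_of_DSigmaU_lt Sap hlt
  refine ⟨F, δ, hF, hδ, hev.mono fun i hi => ?_⟩
  by_contra hne
  rw [not_isEmpty_iff] at hne
  rw [zero_mul] at hi
  exact hi.not_ge (coverD_nonneg _)

/-- If one factor has sofic mean topological dimension `-∞`, then so has any space mapping to it. -/
theorem mdimSigma_eq_bot_of_factor {G P X : Type*} [Group G] [TopologicalSpace P] [CompactSpace P]
    [TopologicalSpace X] [MulAction G P] [MulAction G X] (Sap : SoficApprox G)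
    (ρP : ContPseudoMetric P) (hρP : ρP.IsCompatMetric) (ρ : ContPseudoMetric X) {π : P → X}
    (hπ : Continuous π) (heq : Equivariant G π) (h : mdimSigma Sap ρ = ⊥) :
    mdimSigma Sap ρP = ⊥ := by
  obtain ⟨F, η, hF, hη, hev⟩ := exists_eventually_isEmpty_MapSpace Sap h
  obtain ⟨δ, hδ, hproj⟩ := exists_comp_mem_MapSpace (G := G) ρP hρP ρ hπ heq hη
  refine le_bot_iff.1 (iSup₂_le fun 𝒰 _ => DSigmaU_le_of_eventually Sap hF hδ ?_)
  filter_upwards [hev, Sap.d_tendsto.eventually_gt_atTop 0] with i hi hd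
  have hempty : IsEmpty (MapSpace ρP F δ (Sap.σ i)) :=
    ⟨fun φ => hi.false ⟨_, hproj F _ _ φ.1 φ.2⟩⟩
  rw [coverDMap, coverD_of_isEmpty, ← div_eq_mul_inv,
    EReal.bot_div_of_pos_ne_top (coe_natCast_pos hd) (EReal.coe_ne_top _)]

theorem sum_eq_top_of_mem {ι : Type*} {S : Finset ι} {f : ι → EReal} (hbot : ∀ n, f n ≠ ⊥) {n : ι}
    (hn : n ∈ S) (htop : f n = ⊤) : ∑ n ∈ S, f n = ⊤ := by
  rw [← Finset.add_sum_erase S f hn, htop]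
  refine EReal.top_add_of_ne_bot ?_
  refine Finset.sum_induction f (· ≠ ⊥) (fun a b ha hb => ?_) EReal.zero_ne_bot fun m _ => hbot m
  simp [EReal.add_eq_bot_iff, ha, hb]

/-- The bound for a single cover of the product, refined by a box cover. -/
theorem DSigmaU_pi_le {G : Type*} [Group G] (Sap : SoficApprox G)
    {ι : Type*} [Countable ι] (X : ι → Type*)
    [∀ n, TopologicalSpace (X n)] [∀ n, CompactSpace (X n)] [∀ n, MetrizableSpace (X n)]
    [∀ n, MulAction G (X n)] (ρ : ∀ n, ContPseudoMetric (X n))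
    (ρP : ContPseudoMetric (∀ n, X n)) (hρP : ρP.IsCompatMetric)
    {𝒰 : Finset (Set (∀ n, X n))} (S : Finset ι) (𝒱 : ∀ n, Finset (Set (X n)))
    (h𝒱 : ∀ n, IsFinOpenCover (𝒱 n))
    (hbox : ∀ v : ∀ n, Set (X n), (∀ n ∈ S, v n ∈ 𝒱 n) → (∃ x : ∀ n, X n, ∀ n ∈ S, x n ∈ v n) →
        ∃ U ∈ 𝒰, {x : ∀ n, X n | ∀ n ∈ S, x n ∈ v n} ⊆ U)
    (hbot : ∀ n, mdimSigma Sap (ρ n) ≠ ⊥) :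
    DSigmaU Sap 𝒰 ρP ≤ ∑ n ∈ S, mdimSigma Sap (ρ n) := by
  by_cases htop : ∃ n ∈ S, mdimSigma Sap (ρ n) = ⊤
  · obtain ⟨n, hn, hnt⟩ := htop
    rw [sum_eq_top_of_mem hbot hn hnt]
    exact le_top
  push Not at htop
  set m : ι → ℝ := fun n => (mdimSigma Sap (ρ n)).toReal
  have hmcoe : ∀ n ∈ S, mdimSigma Sap (ρ n) = (m n : EReal) := fun n hn =>
    (EReal.coe_toReal (htop n hn) (hbot n)).symm
  have hsum : ∑ n ∈ S, mdimSigma Sap (ρ n) = ((∑ n ∈ S, m n : ℝ) : EReal) := by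
    rw [Finset.sum_congr rfl hmcoe]
    exact (map_sum (⟨⟨Real.toEReal, EReal.coe_zero⟩, EReal.coe_add⟩ : ℝ →+ EReal) m S).symm
  rw [hsum, ← EReal.le_of_forall_lt_iff_le]
  intro c hc
  rw [EReal.coe_lt_coe_iff] at hc
  set ε : ℝ := (c - ∑ n ∈ S, m n) / (S.card + 1)
  have hεpos : 0 < ε := div_pos (by linarith) (by positivity)
  have hsumε : ∑ n ∈ S, (m n + ε) ≤ c := by
    have h1 : ε * (S.card + 1) = c - ∑ n ∈ S, m n := div_mul_cancel₀ _ (by positivity)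
    rw [Finset.sum_add_distrib, Finset.sum_const, nsmul_eq_mul]
    linarith
  have hex : ∀ n, ∃ (E : Finset G) (η : ℝ), 0 < η ∧ (n ∈ S → ∀ᶠ i in atTop,
      coverDMap (𝒱 n) (ρ n) E η (Sap.σ i) < (((m n + ε) * (Sap.d i : ℝ) : ℝ) : EReal)) := by
    intro n
    by_cases hn : n ∈ S
    · have hlt : DSigmaU Sap (𝒱 n) (ρ n) < ((m n + ε : ℝ) : EReal) := by
        refine (DSigmaU_le_mdimSigma Sap (h𝒱 n) (ρ n)).trans_lt ?_
        rw [hmcoe n hn, EReal.coe_lt_coe_iff]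
        linarith
      obtain ⟨E, η, -, hη, hev⟩ := exists_eventually_of_DSigmaU_lt Sap hlt
      exact ⟨E, η, hη, fun _ => hev⟩
    · exact ⟨∅, 1, one_pos, fun h => absurd h hn⟩
  choose E η hη hev using hex
  choose δ hδ hproj using fun n => exists_comp_mem_MapSpace (G := G) ρP hρP (ρ n)
    (continuous_apply n) (fun _ _ => rfl) (hη n)
  obtain ⟨δ', hδ', hδ'le⟩ : ∃ δ' > 0, ∀ n ∈ S, δ' ≤ δ n := by
    rcases S.eq_empty_or_nonempty with rfl | hS
    · exact ⟨1, one_pos, by simp⟩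
    · obtain ⟨n, -, hn⟩ := S.exists_min_image δ hS
      exact ⟨δ n, hδ n, hn⟩
  refine DSigmaU_le_of_eventually Sap (F := insert 1 (S.biUnion E)) (Finset.insert_nonempty _ _)
    hδ' ?_
  filter_upwards [(Filter.eventually_all_finset S).2 hev, Sap.d_tendsto.eventually_gt_atTop 0]
    with i hi hd
  have hle := coverDMap_pi_le X ρ ρP S 𝒱 hbox (insert 1 (S.biUnion E)) δ' E η
    (fun n hn φ hφ => hproj n (E n) _ _ φ (MapSpace_subset ρP
      ((Finset.subset_biUnion_of_mem E hn).trans (Finset.subset_insert _ _)) (hδ'le n hn) _ hφ))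
    (fun n => (m n + ε) * (Sap.d i : ℝ)) hi
  rw [← div_eq_mul_inv, EReal.div_le_iff_le_mul (coe_natCast_pos hd) (EReal.coe_ne_top _)]
  refine hle.trans ?_
  rw [← EReal.coe_mul, EReal.coe_le_coe_iff, ← Finset.sum_mul, mul_comm]
  exact mul_le_mul_of_nonneg_left hsumε (Nat.cast_nonneg _)

/-- For a countable family of `G`-spaces, the sofic mean topological dimension of
the product action is at most the sum of those of the factors, interpreted as the supremum
of the finite partial sums when all terms are `≥ 0`, and as `−∞` when some term is `−∞`. -/
theorem mdimSigma_prod_le {G : Type*} [Group G] [Countable G] (Sap : SoficApprox G)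
    {ι : Type*} [Countable ι] (X : ι → Type*)
    [∀ n, TopologicalSpace (X n)] [∀ n, CompactSpace (X n)] [∀ n, MetrizableSpace (X n)]
    [∀ n, MulAction G (X n)] [∀ n, ContinuousConstSMul G (X n)]
    (ρ : ∀ n, ContPseudoMetric (X n)) (hρ : ∀ n, (ρ n).IsCompatMetric)
    (ρP : ContPseudoMetric (∀ n, X n)) (hρP : ρP.IsCompatMetric) :
    mdimSigma Sap ρP ≤
      if ∃ n, mdimSigma Sap (ρ n) = ⊥ then (⊥ : EReal)
      else ⨆ S : Finset ι, ∑ n ∈ S, mdimSigma Sap (ρ n) := by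
  split_ifs with h
  · obtain ⟨n, hn⟩ := h
    exact (mdimSigma_eq_bot_of_factor Sap ρP hρP (ρ n) (continuous_apply n)
      (fun _ _ => rfl) hn).le
  · push Not at h
    refine iSup₂_le fun 𝒰 h𝒰 => ?_
    obtain ⟨S, 𝒱, h𝒱, hbox⟩ := exists_box_refinement X h𝒰
    exact (DSigmaU_pi_le Sap X ρ ρP hρP S 𝒱 h𝒱 hbox h).trans
      (le_iSup (fun S : Finset ι => ∑ n ∈ S, mdimSigma Sap (ρ n)) S)

end SoficMD
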